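/- For every strongly connected simple directed graph D on n ≥ 3 vertices, the principal ratio satisfies γ(D) ≤ (2/3)·(n/(n−1) + (1/(n−1)!)·Σ_{i=1}^{n−3} i!)·(n−1)!. -/

import Mathlib

namespace PR

/-- Out-degree of `u` in the digraph on vertex set `{1,…,n} ⊆ ℕ` with adjacency `E`. -/
def outDeg (n : ℕ) (E : ℕ → ℕ → Bool) (u : ℕ) : ℕ :=
  ((Finset.Icc 1 n).filter (fun v => E u v)).card

/-- In-degree of `u`. -/
def inDeg (n : ℕ) (E : ℕ → ℕ → Bool) (u : ℕ) : ℕ :=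
  ((Finset.Icc 1 n).filter (fun v => E v u)).card

/-- `E` is a simple digraph on the vertex set `{1,…,n}`: all edges join distinct
vertices of `{1,…,n}` (no loops; the `Bool`-valued adjacency precludes multi-edges). -/
def IsDigraph (n : ℕ) (E : ℕ → ℕ → Bool) : Prop :=
  ∀ u v, E u v = true → u ∈ Finset.Icc 1 n ∧ v ∈ Finset.Icc 1 n ∧ u ≠ v

/-- `WalkLen E k u v` : there is a directed walk of length `k` from `u` to `v`. -/
def WalkLen (E : ℕ → ℕ → Bool) : ℕ → ℕ → ℕ → Prop
  | 0, u, v => u = v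
  | (k+1), u, v => ∃ w, E u w = true ∧ WalkLen E k w v

/-- Every vertex reaches every other vertex by a directed walk. -/
def StronglyConnected (n : ℕ) (E : ℕ → ℕ → Bool) : Prop :=
  ∀ u ∈ Finset.Icc 1 n, ∀ v ∈ Finset.Icc 1 n, ∃ k, WalkLen E k u v

/-- Directed distance: number of edges in a shortest directed path from `u` to `v`. -/
noncomputable def dist (E : ℕ → ℕ → Bool) (u v : ℕ) : ℕ :=
  sInf {k | WalkLen E k u v}

/-- Distance between two sets of vertices. -/
noncomputable def setDist (E : ℕ → ℕ → Bool) (A B : Set ℕ) : ℕ :=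
  sInf {k | ∃ a ∈ A, ∃ b ∈ B, dist E a b = k}

/-- `φ` is the Perron vector of the simple random walk on the digraph: a positive
probability distribution on `{1,…,n}` which is stationary, i.e. `φ P = φ` where
`P(u,v) = 1/d⁺(u)` for edges `(u,v)` and `0` otherwise. -/
def IsPerron (n : ℕ) (E : ℕ → ℕ → Bool) (φ : ℕ → ℝ) : Prop :=
  (∀ v ∈ Finset.Icc 1 n, 0 < φ v) ∧
  (∑ v ∈ Finset.Icc 1 n, φ v = 1) ∧
  (∀ v ∈ Finset.Icc 1 n, φ v =
    ∑ u ∈ Finset.Icc 1 n, if E u v then φ u / (outDeg n E u : ℝ) else 0)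

/-- The principal ratio `γ = (max_u φ(u)) / (min_u φ(u))` of a vector `φ` on `{1,…,n}`. -/
noncomputable def pratio (n : ℕ) (φ : ℕ → ℝ) : ℝ :=
  if h : (Finset.Icc 1 n).Nonempty then
    ((Finset.Icc 1 n).sup' h φ) / ((Finset.Icc 1 n).inf' h φ)
  else 0

/-- Vertices attaining the maximum of `φ`. -/
def Vmax (n : ℕ) (φ : ℕ → ℝ) : Set ℕ :=
  {v | v ∈ Finset.Icc 1 n ∧ ∀ u ∈ Finset.Icc 1 n, φ u ≤ φ v}

/-- Vertices attaining the minimum of `φ`. -/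
def Vmin (n : ℕ) (φ : ℕ → ℝ) : Set ℕ :=
  {v | v ∈ Finset.Icc 1 n ∧ ∀ u ∈ Finset.Icc 1 n, φ v ≤ φ u}

/-- The flow along `u → v` of the random walk with distribution `φ`. -/
noncomputable def flow (n : ℕ) (E : ℕ → ℕ → Bool) (φ : ℕ → ℝ) (u v : ℕ) : ℝ :=
  if E u v then φ u / (outDeg n E u : ℝ) else 0

/-- `q k, q (k-1), …, q 0` is a shortest path from `q k` to `q 0`: the vertices are distinct,
consecutive ones are joined, and no edge skips ahead. -/
structure IsGeodesic (n : ℕ) (E : ℕ → ℕ → Bool) (k : ℕ) (q : ℕ → ℕ) : Prop where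
  mem : ∀ i ≤ k, q i ∈ Finset.Icc 1 n
  edge : ∀ i < k, E (q (i + 1)) (q i) = true
  inj : Set.InjOn q (Set.Iic k)
  no_skip : ∀ i ≤ k, ∀ j, j + 1 < i → ¬ E (q i) (q j) = true

section Distance

variable {n : ℕ} {E : ℕ → ℕ → Bool}

lemma walkLen_dist (hSC : StronglyConnected n E) {u v : ℕ} (hu : u ∈ Finset.Icc 1 n)
    (hv : v ∈ Finset.Icc 1 n) : WalkLen E (dist E u v) u v :=
  Nat.sInf_mem (hSC u hu v hv)

lemma dist_le_of_walkLen {k u v : ℕ} (h : WalkLen E k u v) : dist E u v ≤ k :=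
  Nat.sInf_le h

lemma dist_le_succ_of_edge (hD : IsDigraph n E) (hSC : StronglyConnected n E) {u v y : ℕ}
    (hy : y ∈ Finset.Icc 1 n) (h : E u v = true) : dist E u y ≤ dist E v y + 1 :=
  dist_le_of_walkLen ⟨v, h, walkLen_dist hSC (hD u v h).2.1 hy⟩

lemma exists_path_of_dist_eq (hD : IsDigraph n E) (hSC : StronglyConnected n E) {y : ℕ}
    (hy : y ∈ Finset.Icc 1 n) (k : ℕ) : ∀ u ∈ Finset.Icc 1 n, dist E u y = k →
    ∃ q : ℕ → ℕ, q k = u ∧ (∀ i ≤ k, q i ∈ Finset.Icc 1 n ∧ dist E (q i) y = i) ∧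
      ∀ i < k, E (q (i + 1)) (q i) = true := by
  induction k with
  | zero =>
    intro u hu h
    refine ⟨fun _ => u, rfl, fun i hi => ?_, fun i hi => absurd hi (by omega)⟩
    obtain rfl : i = 0 := by omega
    exact ⟨hu, h⟩
  | succ k ih =>
    intro u hu h
    have hw := walkLen_dist hSC hu hy
    rw [h] at hw
    obtain ⟨v, huv, hv⟩ := hw
    have h1 := dist_le_of_walkLen hv
    have h2 := dist_le_succ_of_edge hD hSC hy huv
    obtain ⟨q, hq, hmem, hedge⟩ := ih v (hD u v huv).2.1 (by omega)
    refine ⟨Function.update q (k + 1) u, by simp, fun i hi => ?_, fun i hi => ?_⟩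
    · rcases eq_or_ne i (k + 1) with rfl | hne
      · simpa using ⟨Finset.mem_Icc.mp hu, h⟩
      · rw [Function.update_of_ne hne]
        exact hmem i (by omega)
    · rw [Function.update_of_ne (show i ≠ k + 1 by omega)]
      rcases eq_or_ne i k with rfl | hne
      · simpa [hq] using huv
      · rw [Function.update_of_ne (show i + 1 ≠ k + 1 by omega)]
        exact hedge i (by omega)

lemma exists_geodesic (hD : IsDigraph n E) (hSC : StronglyConnected n E) {x y : ℕ}
    (hx : x ∈ Finset.Icc 1 n) (hy : y ∈ Finset.Icc 1 n) :
    ∃ k q, IsGeodesic n E k q ∧ q k = x ∧ q 0 = y := by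
  obtain ⟨q, hq, hmem, hedge⟩ := exists_path_of_dist_eq hD hSC hy _ x hx rfl
  refine ⟨dist E x y, q, ⟨fun i hi => (hmem i hi).1, hedge, ?_, ?_⟩, hq, ?_⟩
  · intro i hi j hj hij
    rw [← (hmem i hi).2, ← (hmem j hj).2, hij]
  · intro i hi j hj hE
    have := dist_le_succ_of_edge hD hSC hy hE
    rw [(hmem i hi).2, (hmem j (by omega)).2] at this
    omega
  · have h := walkLen_dist hSC (hmem 0 (Nat.zero_le _)).1 hy
    rw [(hmem 0 (Nat.zero_le _)).2] at h
    exact h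

end Distance

section Flow

variable {n : ℕ} {E : ℕ → ℕ → Bool} {φ : ℕ → ℝ}

lemma outDeg_pos (hD : IsDigraph n E) {u v : ℕ} (h : E u v = true) : 0 < outDeg n E u :=
  Finset.card_pos.mpr ⟨v, Finset.mem_filter.mpr ⟨(hD u v h).2.1, h⟩⟩

lemma flow_nonneg (hφ : IsPerron n E φ) {u : ℕ} (hu : u ∈ Finset.Icc 1 n) (v : ℕ) :
    0 ≤ flow n E φ u v := by
  have := hφ.1 u hu
  unfold flow
  split_ifs <;> positivity

lemma flow_le (hφ : IsPerron n E φ) {u : ℕ} (hu : u ∈ Finset.Icc 1 n) (v : ℕ) :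
    flow n E φ u v ≤ φ u / outDeg n E u := by
  have := hφ.1 u hu
  unfold flow
  split_ifs
  · exact le_rfl
  · positivity

lemma sum_flow_eq {u : ℕ} (hdeg : 0 < outDeg n E u) :
    ∑ v ∈ Finset.Icc 1 n, flow n E φ u v = φ u := by
  have hd : (outDeg n E u : ℝ) ≠ 0 := by exact_mod_cast hdeg.ne'
  unfold flow
  rw [← Finset.sum_filter, Finset.sum_const, nsmul_eq_mul]
  exact mul_div_cancel₀ _ hd

/-- The total flow out of a set of vertices equals the total flow into it. -/
lemma sum_flow_out_eq_sum_flow_in (hφ : IsPerron n E φ)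
    (hdeg : ∀ u ∈ Finset.Icc 1 n, 0 < outDeg n E u) {A : Finset ℕ} (hA : A ⊆ Finset.Icc 1 n) :
    ∑ u ∈ A, ∑ v ∈ Finset.Icc 1 n \ A, flow n E φ u v =
      ∑ u ∈ Finset.Icc 1 n \ A, ∑ v ∈ A, flow n E φ u v := by
  have hout : ∑ u ∈ A, φ u = ∑ u ∈ A, ∑ v ∈ Finset.Icc 1 n, flow n E φ u v :=
    Finset.sum_congr rfl fun u hu => (sum_flow_eq (hdeg u (hA hu))).symm
  have hin : ∑ v ∈ A, φ v = ∑ u ∈ Finset.Icc 1 n, ∑ v ∈ A, flow n E φ u v := by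
    rw [Finset.sum_comm]
    exact Finset.sum_congr rfl fun v hv => hφ.2.2 v (hA hv)
  rw [← Finset.sum_sdiff hA] at hin
  have hsplit : ∑ u ∈ A, ∑ v ∈ Finset.Icc 1 n, flow n E φ u v =
      ∑ u ∈ A, ∑ v ∈ Finset.Icc 1 n \ A, flow n E φ u v +
        ∑ u ∈ A, ∑ v ∈ A, flow n E φ u v := by
    rw [← Finset.sum_add_distrib]
    exact Finset.sum_congr rfl fun u _ => (Finset.sum_sdiff hA).symm
  linarith

lemma sum_flow_le (hφ : IsPerron n E φ) {u : ℕ} (hu : u ∈ Finset.Icc 1 n)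
    (hdeg : 0 < outDeg n E u) {B : Finset ℕ} (hB : B ⊆ Finset.Icc 1 n) :
    ∑ v ∈ B, flow n E φ u v ≤ φ u :=
  (Finset.sum_le_sum_of_subset_of_nonneg hB fun v _ _ => flow_nonneg hφ hu v).trans_eq
    (sum_flow_eq hdeg)

end Flow

namespace IsGeodesic

variable {n k : ℕ} {E : ℕ → ℕ → Bool} {φ : ℕ → ℝ} {q : ℕ → ℕ}

lemma card_image (hq : IsGeodesic n E k q) {s : Finset ℕ} (hs : ∀ i ∈ s, i ≤ k) :
    (s.image q).card = s.card :=
  Finset.card_image_of_injOn (hq.inj.mono fun i hi => hs i hi)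

lemma image_subset (hq : IsGeodesic n E k q) {s : Finset ℕ} (hs : ∀ i ∈ s, i ≤ k) :
    s.image q ⊆ Finset.Icc 1 n :=
  Finset.image_subset_iff.mpr fun i hi => hq.mem i (hs i hi)

lemma card_sdiff (hq : IsGeodesic n E k q) {s : Finset ℕ} (hs : ∀ i ∈ s, i ≤ k) :
    (Finset.Icc 1 n \ s.image q).card = n - s.card := by
  rw [Finset.card_sdiff_of_subset (hq.image_subset hs), hq.card_image hs, Nat.card_Icc]
  omega

lemma length_lt (hq : IsGeodesic n E k q) : k < n := by
  have hs : ∀ i ∈ Finset.range (k + 1), i ≤ k := fun i hi => by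
    have := Finset.mem_range.mp hi
    omega
  have := Finset.card_le_card (hq.image_subset hs)
  rw [hq.card_image hs, Finset.card_range, Nat.card_Icc] at this
  omega

lemma outDeg_le (hq : IsGeodesic n E k q) (hD : IsDigraph n E) {i : ℕ} (hi : i + 1 ≤ k) :
    outDeg n E (q (i + 1)) ≤ n - (i + 1) := by
  have hs : ∀ j ∈ (Finset.range (i + 2)).erase i, j ≤ k := fun j hj => by
    have := Finset.mem_range.mp (Finset.mem_of_mem_erase hj)
    omega
  have hcard : ((Finset.range (i + 2)).erase i).card = i + 1 := by
    rw [Finset.card_erase_of_mem (by simp), Finset.card_range]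
    omega
  have hsdiff := hq.card_sdiff hs
  rw [hcard] at hsdiff
  rw [← hsdiff]
  refine Finset.card_le_card fun v hv => ?_
  obtain ⟨hv, hE⟩ := Finset.mem_filter.mp hv
  refine Finset.mem_sdiff.mpr ⟨hv, fun hmem => ?_⟩
  obtain ⟨j, hj, rfl⟩ := Finset.mem_image.mp hmem
  obtain ⟨hne, hj⟩ := Finset.mem_erase.mp hj
  have hj := Finset.mem_range.mp hj
  rcases eq_or_ne j (i + 1) with rfl | hne'
  · exact (hD _ _ hE).2.2 rfl
  · exact hq.no_skip _ hi j (by omega) hE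

/-- The flow along one edge of the geodesic is at most the flow leaving the vertices behind it. -/
lemma flow_step_le (hq : IsGeodesic n E k q) (hφ : IsPerron n E φ)
    (hdeg : ∀ u ∈ Finset.Icc 1 n, 0 < outDeg n E u) {i : ℕ} (hi : i < k) :
    φ (q (i + 1)) / outDeg n E (q (i + 1)) ≤
      ((n - (i + 1) : ℕ) : ℝ) * ∑ j ∈ Finset.range i, φ (q (j + 1)) / outDeg n E (q (j + 1)) +
        φ (q 0) := by
  have hs : ∀ j ∈ Finset.range (i + 1), j ≤ k := fun j hj => by
    have := Finset.mem_range.mp hj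
    omega
  set A := (Finset.range (i + 1)).image q with hAdef
  have hA : A ⊆ Finset.Icc 1 n := hq.image_subset hs
  have hi_mem : q i ∈ A := Finset.mem_image_of_mem q (Finset.self_mem_range_succ i)
  have hsucc_mem : q (i + 1) ∈ Finset.Icc 1 n \ A := by
    refine Finset.mem_sdiff.mpr ⟨hq.mem _ hi, fun hmem => ?_⟩
    obtain ⟨j, hj, hjq⟩ := Finset.mem_image.mp hmem
    have := hq.inj (hs j hj) (show i + 1 ≤ k from hi) hjq
    have := Finset.mem_range.mp hj
    omega
  have hcard : (Finset.Icc 1 n \ A).card = n - (i + 1) := by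
    rw [hAdef, hq.card_sdiff hs, Finset.card_range]
  calc φ (q (i + 1)) / outDeg n E (q (i + 1))
      = flow n E φ (q (i + 1)) (q i) := by simp [flow, hq.edge i hi]
    _ ≤ ∑ v ∈ A, flow n E φ (q (i + 1)) v :=
        Finset.single_le_sum (fun v _ => flow_nonneg hφ (hq.mem _ hi) v) hi_mem
    _ ≤ ∑ u ∈ Finset.Icc 1 n \ A, ∑ v ∈ A, flow n E φ u v :=
        Finset.single_le_sum (f := fun u => ∑ v ∈ A, flow n E φ u v)
          (fun u hu => Finset.sum_nonneg fun v _ =>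
            flow_nonneg hφ (Finset.mem_sdiff.mp hu).1 v) hsucc_mem
    _ = ∑ u ∈ A, ∑ v ∈ Finset.Icc 1 n \ A, flow n E φ u v :=
        (sum_flow_out_eq_sum_flow_in hφ hdeg hA).symm
    _ = ∑ j ∈ Finset.range (i + 1), ∑ v ∈ Finset.Icc 1 n \ A, flow n E φ (q j) v :=
        Finset.sum_image fun a ha b hb hab => hq.inj (hs a ha) (hs b hb) hab
    _ = ∑ j ∈ Finset.range i, ∑ v ∈ Finset.Icc 1 n \ A, flow n E φ (q (j + 1)) v +
          ∑ v ∈ Finset.Icc 1 n \ A, flow n E φ (q 0) v := Finset.sum_range_succ' _ _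
    _ ≤ _ := by
        have h0 := hq.mem 0 (Nat.zero_le k)
        refine add_le_add ?_ (sum_flow_le hφ h0 (hdeg _ h0) Finset.sdiff_subset)
        rw [Finset.mul_sum]
        refine Finset.sum_le_sum fun j hj => ?_
        have hj := Finset.mem_range.mp hj
        rw [← hcard, ← nsmul_eq_mul]
        exact Finset.sum_le_card_nsmul _ _ _ fun v _ => flow_le hφ (hq.mem _ (by omega)) v

lemma sum_flow_mul_factorial_le (hq : IsGeodesic n E k q) (hφ : IsPerron n E φ)
    (hdeg : ∀ u ∈ Finset.Icc 1 n, 0 < outDeg n E u) {i : ℕ} (hi : i ≤ k) :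
    (∑ j ∈ Finset.range i, φ (q (j + 1)) / outDeg n E (q (j + 1))) * ((n - i).factorial : ℝ) ≤
      (∑ j ∈ Finset.Ico (n - i) n, (j.factorial : ℝ)) * φ (q 0) := by
  induction i with
  | zero => simp
  | succ i ih =>
    have hlt := hq.length_lt
    have hstep := hq.flow_step_le hφ hdeg hi
    have ih := ih (by omega)
    obtain ⟨c, hc⟩ : ∃ c, n - (i + 1) = c := ⟨_, rfl⟩
    have hc' : n - i = c + 1 := by omega
    rw [hc] at hstep ⊢
    rw [hc', Nat.factorial_succ] at ih
    rw [Finset.sum_range_succ, Finset.sum_eq_sum_Ico_succ_bot (by omega)]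
    push_cast at ih
    have := mul_le_mul_of_nonneg_right hstep (Nat.cast_nonneg (α := ℝ) c.factorial)
    linarith

end IsGeodesic

lemma three_mul_sq_le_two_mul_factorial_succ {c : ℕ} (hc : 1 ≤ c) :
    3 * c ^ 2 ≤ 2 * (c + 1).factorial := by
  rcases Nat.lt_or_ge c 2 with h | h
  · obtain rfl : c = 1 := by omega
    decide
  · induction c, h using Nat.le_induction with
    | base => decide
    | succ c h ih =>
      have ih := ih (by omega)
      rw [Nat.factorial_succ]
      nlinarith

lemma three_mul_le_two_mul_sum_factorial {c : ℕ} (hc : 2 ≤ c) :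
    3 * c ≤ 2 * ∑ j ∈ Finset.Ico 1 (c + 1), j.factorial := by
  induction c, hc using Nat.le_induction with
  | base => decide
  | succ c h ih =>
    rw [Finset.sum_Ico_succ_top (by omega)]
    have := Nat.self_le_factorial (c + 1)
    omega

/-- The sharp numerical estimate behind the bound on the principal ratio. -/
lemma sum_factorial_estimate {n c : ℕ} (hn : 3 ≤ n) (hc : 1 ≤ c) (hcn : c < n) {S μ : ℝ}
    (hμ : 0 ≤ μ)
    (hS : S * ((c + 1).factorial : ℝ) ≤ (∑ j ∈ Finset.Ico (c + 1) n, (j.factorial : ℝ)) * μ) :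
    c * (c * S + μ) ≤ (2 / 3) * (∑ j ∈ Finset.Ico 1 n, (j.factorial : ℝ)) * μ := by
  have hsplit : ∑ j ∈ Finset.Ico 1 n, (j.factorial : ℝ) =
      ∑ j ∈ Finset.Ico 1 (c + 1), (j.factorial : ℝ) +
        ∑ j ∈ Finset.Ico (c + 1) n, (j.factorial : ℝ) :=
    (Finset.sum_Ico_consecutive _ (by omega) hcn).symm
  rcases Nat.lt_or_ge c 2 with h | h
  · obtain rfl : c = 1 := by omega
    have hT : (2 : ℝ) ≤ ∑ j ∈ Finset.Ico 2 n, (j.factorial : ℝ) := by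
      have := Finset.single_le_sum (f := fun j => (j.factorial : ℝ))
        (fun j _ => by positivity) (Finset.mem_Ico.mpr ⟨le_rfl, hn⟩ : 2 ∈ Finset.Ico 2 n)
      simpa using this
    norm_num [Nat.factorial] at hS hsplit ⊢
    rw [hsplit]
    nlinarith [mul_le_mul_of_nonneg_right hT hμ]
  · have hsq : (3 : ℝ) * c ^ 2 ≤ 2 * ((c + 1).factorial : ℝ) := by
      exact_mod_cast three_mul_sq_le_two_mul_factorial_succ hc
    have hlin : (3 : ℝ) * c ≤ 2 * ∑ j ∈ Finset.Ico 1 (c + 1), (j.factorial : ℝ) := by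
      exact_mod_cast three_mul_le_two_mul_sum_factorial h
    rw [hsplit]
    have hSbound : (c : ℝ) ^ 2 * S ≤
        (2 / 3) * (∑ j ∈ Finset.Ico (c + 1) n, (j.factorial : ℝ)) * μ := by
      rcases le_or_gt S 0 with hneg | hpos
      · exact (mul_nonpos_of_nonneg_of_nonpos (by positivity) hneg).trans (by positivity)
      · nlinarith [mul_le_mul_of_nonneg_right hsq hpos.le]
    nlinarith [mul_le_mul_of_nonneg_right hlin hμ]

/-- Along a geodesic, the stationary distribution drops by at most `(2/3) ∑_{j=1}^{n-1} j!`. -/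
lemma IsGeodesic.perron_le {n k : ℕ} {E : ℕ → ℕ → Bool} {φ : ℕ → ℝ} {q : ℕ → ℕ}
    (hq : IsGeodesic n E k q) (hn : 3 ≤ n) (hD : IsDigraph n E) (hφ : IsPerron n E φ)
    (hdeg : ∀ u ∈ Finset.Icc 1 n, 0 < outDeg n E u) :
    φ (q k) ≤ (2 / 3) * (∑ j ∈ Finset.Ico 1 n, (j.factorial : ℝ)) * φ (q 0) := by
  have h0 := hφ.1 _ (hq.mem 0 (Nat.zero_le k))
  have hlt := hq.length_lt
  cases k with
  | zero =>
    have := sum_factorial_estimate (S := 0) (c := n - 1) hn (by omega) (by omega) h0.le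
      (by simp; positivity)
    have h1 : (1 : ℝ) ≤ (n - 1 : ℕ) := by exact_mod_cast (by omega : 1 ≤ n - 1)
    nlinarith
  | succ i =>
    have hmem := hq.mem (i + 1) le_rfl
    have hd : (0 : ℝ) < outDeg n E (q (i + 1)) := by exact_mod_cast hdeg _ hmem
    have hdle : (outDeg n E (q (i + 1)) : ℝ) ≤ (n - (i + 1) : ℕ) := by
      exact_mod_cast hq.outDeg_le hD le_rfl
    have hf : 0 ≤ φ (q (i + 1)) / outDeg n E (q (i + 1)) := div_nonneg (hφ.1 _ hmem).le hd.le
    have hS := hq.sum_flow_mul_factorial_le hφ hdeg (Nat.le_succ i)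
    rw [show n - i = n - (i + 1) + 1 by omega] at hS
    calc φ (q (i + 1))
        = outDeg n E (q (i + 1)) * (φ (q (i + 1)) / outDeg n E (q (i + 1))) := by field_simp
      _ ≤ (n - (i + 1) : ℕ) * (φ (q (i + 1)) / outDeg n E (q (i + 1))) := by gcongr
      _ ≤ _ := mul_le_mul_of_nonneg_left (hq.flow_step_le hφ hdeg (Nat.lt_succ_self i))
          (Nat.cast_nonneg _)
      _ ≤ _ := sum_factorial_estimate hn (by omega) (by omega) h0.le hS

lemma StronglyConnected.outDeg_pos {n : ℕ} {E : ℕ → ℕ → Bool} (hSC : StronglyConnected n E)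
    (hD : IsDigraph n E) (hn : 2 ≤ n) {u : ℕ} (hu : u ∈ Finset.Icc 1 n) :
    0 < outDeg n E u := by
  obtain ⟨v, hv, hne⟩ := Finset.exists_mem_ne (s := Finset.Icc 1 n) (by simp; omega) u
  obtain ⟨_ | k, hk⟩ := hSC u hu v hv
  · exact absurd hk hne.symm
  · obtain ⟨w, hw, -⟩ := hk
    exact PR.outDeg_pos hD hw

lemma bound_eq_sum_factorial {n : ℕ} (hn : 3 ≤ n) :
    (2/3 : ℝ) *
      ((n : ℝ) / ((n : ℝ) - 1) +
        (1 / (Nat.factorial (n - 1) : ℝ)) *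
          ∑ i ∈ Finset.Icc 1 (n - 3), (Nat.factorial i : ℝ)) *
      (Nat.factorial (n - 1) : ℝ) =
    (2 / 3) * ∑ j ∈ Finset.Ico 1 n, (j.factorial : ℝ) := by
  obtain ⟨t, rfl⟩ : ∃ t, n = t + 3 := ⟨n - 3, by omega⟩
  rw [show t + 3 - 1 = t + 1 + 1 by omega, show t + 3 - 3 = t by omega,
    Finset.sum_Ico_succ_top (by omega), Finset.sum_Ico_succ_top (by omega),
    show Finset.Ico 1 (t + 1) = Finset.Icc 1 t from Finset.Ico_succ_right_eq_Icc 1 t,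
    Nat.factorial_succ (t + 1)]
  have h1 : ((t + 1).factorial : ℝ) ≠ 0 := by positivity
  have h2 : (t : ℝ) + 2 ≠ 0 := by positivity
  push_cast
  rw [show (t : ℝ) + 3 - 1 = t + 2 by ring, show (t : ℝ) + 1 + 1 = t + 2 by ring]
  field_simp
  ring

/-- For every strongly connected simple digraph on `n ≥ 3` vertices,
`γ(D) ≤ (2/3)(n/(n-1) + (1/(n-1)!) ∑_{i=1}^{n-3} i!)(n-1)!`. -/
theorem stmt14 (n : ℕ) (hn : 3 ≤ n) (E : ℕ → ℕ → Bool) (φ : ℕ → ℝ)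
    (hD : IsDigraph n E) (hSC : StronglyConnected n E) (hφ : IsPerron n E φ) :
    pratio n φ ≤ (2/3 : ℝ) *
      ((n : ℝ) / ((n : ℝ) - 1) +
        (1 / (Nat.factorial (n - 1) : ℝ)) *
          ∑ i ∈ Finset.Icc 1 (n - 3), (Nat.factorial i : ℝ)) *
      (Nat.factorial (n - 1) : ℝ) := by
  have hne : (Finset.Icc 1 n).Nonempty := ⟨1, by simp; omega⟩
  obtain ⟨x, hx, hxeq⟩ := Finset.exists_mem_eq_sup' hne φ
  obtain ⟨y, hy, hyeq⟩ := Finset.exists_mem_eq_inf' hne φ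
  rw [bound_eq_sum_factorial hn, pratio, dif_pos hne, hxeq, hyeq, div_le_iff₀ (hφ.1 y hy)]
  obtain ⟨k, q, hq, rfl, rfl⟩ := exists_geodesic hD hSC hx hy
  exact hq.perron_le hn hD hφ fun u hu => hSC.outDeg_pos hD (by omega) hu

end PR
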